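/- arXiv:1505.05165 — 11 statements merged into one kernel-verified Lean document; each statement's English description precedes it below -/
import Mathlib

section
/- Let G = A ⋊ X be an internal semidirect product where A is an abelian normal subgroup, X is a complement, and the centralizer of A in X is trivial. Let H ≤ G be a subgroup of finite index m and f : H → G a homomorphism with f(A ∩ H) ≤ A. Set A₀ = A ∩ H, Y = AH ∩ X, and Ḣ = A₀Y. Then Ḣ is a subgroup of G with [G : Ḣ] = [G : H] = [A : A₀]·[X : Y]; moreover, if H is normal in G then Ḣ is normal in G. -/
namespace Subgroup

variable {G : Type*} [Group G]

/-- If `X ≤ K` meets every left coset of `L` in `K`, then `L` has the same relative index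
in `X` and in `K`. -/
theorem relIndex_eq_relIndex_of_forall_exists_mul {L X K : Subgroup G} (hXK : X ≤ K)
    (h : ∀ g ∈ K, ∃ x ∈ X, ∃ l ∈ L, x * l = g) : L.relIndex X = L.relIndex K := by
  refine Nat.card_congr (Equiv.ofBijective (quotientSubgroupOfEmbeddingOfLE L hXK)
    ⟨(quotientSubgroupOfEmbeddingOfLE L hXK).injective, fun q => ?_⟩)
  induction q using QuotientGroup.induction_on with
  | H g =>
    obtain ⟨x, hx, l, hl, hg⟩ := h g g.2
    refine ⟨QuotientGroup.mk ⟨x, hx⟩, ?_⟩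
    rw [quotientSubgroupOfEmbeddingOfLE_apply_mk, QuotientGroup.eq, mem_subgroupOf]
    simpa [← hg] using hl

/-- The index of a subgroup containing a normal subgroup `A` can be computed inside any
supplement `X` of `A`. -/
theorem relIndex_eq_index_of_sup_eq_top {A X L : Subgroup G} [A.Normal] (hAL : A ≤ L)
    (hAX : A ⊔ X = ⊤) : L.relIndex X = L.index := by
  rw [← relIndex_top_right]
  refine relIndex_eq_relIndex_of_forall_exists_mul le_top fun g hg => ?_
  rw [← hAX, sup_comm] at hg
  obtain ⟨x, hx, a, ha, rfl⟩ := mem_sup_of_normal_right.1 hg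
  exact ⟨x, hx, a, hAL ha, rfl⟩

theorem index_eq_relIndex_inf_mul_index_sup (A D : Subgroup G) [A.Normal] :
    D.index = (A ⊓ D).relIndex A * (A ⊔ D).index := by
  rw [inf_relIndex_left, relIndex_eq_relIndex_of_forall_exists_mul le_sup_left
    fun _ => mem_sup_of_normal_left.1, relIndex_mul_index le_sup_right]

/-- An element of `A ⊔ H` normalizes `A ⊓ H` when `A` is abelian and normal. -/
theorem conj_mem_inf_of_mem_sup {A H : Subgroup G} [A.Normal]
    (hA : ∀ a ∈ A, ∀ b ∈ A, a * b = b * a) {k y : G} (hk : k ∈ A ⊓ H) (hy : y ∈ A ⊔ H) :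
    y * k * y⁻¹ ∈ A ⊓ H := by
  obtain ⟨a, ha, h, hh, rfl⟩ := mem_sup_of_normal_left.1 hy
  have h1 : h * k * h⁻¹ ∈ A := Normal.conj_mem ‹_› _ hk.1 _
  have h2 : a * h * k * (a * h)⁻¹ = h * k * h⁻¹ := by
    calc a * h * k * (a * h)⁻¹ = a * (h * k * h⁻¹) * a⁻¹ := by group
      _ = h * k * h⁻¹ := by rw [hA a ha _ h1]; group
  rw [h2]
  exact ⟨h1, H.mul_mem (H.mul_mem hh hk.2) (H.inv_mem hh)⟩

/-- Commutators of `A` with `A ⊔ H` lie in `A ⊓ H` when `A` is abelian and both are normal. -/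
theorem commutator_mem_inf_of_mem_sup {A H : Subgroup G} [A.Normal] [H.Normal]
    (hA : ∀ a ∈ A, ∀ b ∈ A, a * b = b * a) {a y : G} (ha : a ∈ A) (hy : y ∈ A ⊔ H) :
    a * y * a⁻¹ * y⁻¹ ∈ A ⊓ H := by
  obtain ⟨b, hb, h, hh, rfl⟩ := mem_sup_of_normal_left.1 hy
  have h1 : h * a⁻¹ * h⁻¹ ∈ A := Normal.conj_mem ‹_› _ (A.inv_mem ha) _
  have h2 : a * (b * h) * a⁻¹ * (b * h)⁻¹ = a * (h * a⁻¹ * h⁻¹) := by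
    calc a * (b * h) * a⁻¹ * (b * h)⁻¹ = a * (b * (h * a⁻¹ * h⁻¹)) * b⁻¹ := by group
      _ = a * (h * a⁻¹ * h⁻¹) := by rw [hA b hb _ h1]; group
  rw [h2]
  refine ⟨A.mul_mem ha h1, ?_⟩
  rw [show a * (h * a⁻¹ * h⁻¹) = a * h * a⁻¹ * h⁻¹ by group]
  exact H.mul_mem (Normal.conj_mem ‹_› _ hh _) (H.inv_mem hh)

/-- For `A` abelian and normal, the join of `A ⊓ H` and `(A ⊔ H) ⊓ X` is their product. -/
theorem mem_inf_sup_sup_inf {A H X : Subgroup G} [A.Normal]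
    (hA : ∀ a ∈ A, ∀ b ∈ A, a * b = b * a) {g : G} :
    g ∈ (A ⊓ H) ⊔ ((A ⊔ H) ⊓ X) ↔ ∃ a ∈ A ⊓ H, ∃ y ∈ (A ⊔ H) ⊓ X, g = a * y := by
  constructor
  · intro hg
    have hle : (A ⊔ H) ⊓ X ≤ normalizer (A ⊓ H : Subgroup G) :=
      le_normalizer_iff.2 fun y hy k hk => conj_mem_inf_of_mem_sup hA hk hy.1
    rw [← SetLike.mem_coe, coe_mul_of_right_le_normalizer_left _ _ hle] at hg
    obtain ⟨a, ha, y, hy, rfl⟩ := hg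
    exact ⟨a, ha, y, hy, rfl⟩
  · rintro ⟨a, ha, y, hy, rfl⟩
    exact mul_mem_sup ha hy

end Subgroup

/-- Let `G = A ⋊ X` be an internal semidirect product with `A` abelian normal,
`X` a complement with trivial centralizer of `A` in `X`.  Let `H ≤ G` have finite index and
`f : H → G` a homomorphism with `f(A ∩ H) ≤ A`.  With `A₀ = A ∩ H`, `Y = AH ∩ X` and
`Ḣ = A₀Y`, the set `A₀Y` is a subgroup (namely `A₀ ⊔ Y`), `[G : Ḣ] = [G : H] = [A : A₀]·[X : Y]`,
and if `H` is normal in `G` then so is `Ḣ`. -/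
theorem stmt0 {G : Type*} [Group G] (A X : Subgroup G)
    (hAnormal : A.Normal) (hAab : ∀ a ∈ A, ∀ b ∈ A, a * b = b * a)
    (hAX : A ⊓ X = ⊥) (hG : A ⊔ X = ⊤)
    (hcent : ∀ x ∈ X, (∀ a ∈ A, x * a = a * x) → x = 1)
    (H : Subgroup G) (hfin : H.FiniteIndex)
    (f : H →* G) (hf : ∀ h : H, (h : G) ∈ A → f h ∈ A) :
    ((((A ⊓ H) ⊔ ((A ⊔ H) ⊓ X)) : Subgroup G) : Set G)
        = {g : G | ∃ a ∈ A ⊓ H, ∃ y ∈ (A ⊔ H) ⊓ X, g = a * y} ∧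
    ((A ⊓ H) ⊔ ((A ⊔ H) ⊓ X)).index = H.index ∧
    H.index = ((A ⊓ H).subgroupOf A).index * ((((A ⊔ H) ⊓ X)).subgroupOf X).index ∧
    (H.Normal → ((A ⊓ H) ⊔ ((A ⊔ H) ⊓ X)).Normal) := by
  have hmem {g : G} := Subgroup.mem_inf_sup_sup_inf (H := H) (X := X) hAab (g := g)
  have hinf : A ⊓ ((A ⊓ H) ⊔ ((A ⊔ H) ⊓ X)) = A ⊓ H := by
    refine le_antisymm ?_ (le_inf inf_le_left le_sup_left)
    rintro g ⟨hgA, hg⟩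
    obtain ⟨a, ha, y, hy, rfl⟩ := hmem.1 hg
    have hyA : y ∈ A ⊓ X := ⟨(A.mul_mem_cancel_left ha.1).1 hgA, hy.2⟩
    rw [hAX, Subgroup.mem_bot] at hyA
    rwa [hyA, mul_one]
  have hsup : A ⊔ ((A ⊓ H) ⊔ ((A ⊔ H) ⊓ X)) = A ⊔ H := by
    refine le_antisymm (sup_le le_sup_left
      (sup_le (inf_le_left.trans le_sup_left) inf_le_left)) fun g hg => ?_
    have hgt : g ∈ A ⊔ X := hG ▸ Subgroup.mem_top g
    obtain ⟨a, ha, x, hx, rfl⟩ := Subgroup.mem_sup_of_normal_left.1 hgt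
    have hxL : x ∈ A ⊔ H :=
      ((A ⊔ H).mul_mem_cancel_left (Subgroup.mem_sup_left ha)).1 hg
    exact Subgroup.mul_mem_sup ha (Subgroup.mem_sup_right ⟨hxL, hx⟩)
  refine ⟨Set.ext fun g => hmem, ?_, ?_, fun hH => ⟨fun n hn g => ?_⟩⟩
  · rw [Subgroup.index_eq_relIndex_inf_mul_index_sup A, hinf, hsup,
      ← Subgroup.index_eq_relIndex_inf_mul_index_sup A]
  · change H.index = (A ⊓ H).relIndex A * ((A ⊔ H) ⊓ X).relIndex X
    rw [Subgroup.inf_relIndex_right,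
      Subgroup.relIndex_eq_index_of_sup_eq_top le_sup_left hG,
      ← Subgroup.index_eq_relIndex_inf_mul_index_sup A]
  · obtain ⟨k, hk, y, hy, rfl⟩ := hmem.1 hn
    have hgt : g ∈ A ⊔ X := hG ▸ Subgroup.mem_top g
    obtain ⟨a, ha, x, hx, rfl⟩ := Subgroup.mem_sup_of_normal_left.1 hgt
    have hy' : x * y * x⁻¹ ∈ (A ⊔ H) ⊓ X :=
      ⟨(inferInstance : (A ⊔ H).Normal).conj_mem _ hy.1 _,
        X.mul_mem (X.mul_mem hx hy.2) (X.inv_mem hx)⟩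
    have hk' : (a * x) * k * (a * x)⁻¹ ∈ A ⊓ H :=
      (inferInstance : (A ⊓ H).Normal).conj_mem _ hk _
    refine hmem.2 ⟨_, mul_mem hk' (Subgroup.commutator_mem_inf_of_mem_sup hAab ha hy'.1),
      _, hy', ?_⟩
    group
end

section
/- Let G = A ⋊ X be an internal semidirect product where A is an abelian normal subgroup, X is a complement, and the centralizer of A in X is trivial. Let H ≤ G be a subgroup of finite index, f : H → G a homomorphism with f(A ∩ H) ≤ A, A₀ = A ∩ H, Y = AH ∩ X, Ḣ = A₀Y. Then: (i) for every y ∈ Y there exists v ∈ A with vy ∈ H; (ii) for such y, the X-component of f(vy) (in the unique decomposition f(vy) = w·x with w ∈ A, x ∈ X) does not depend on the choice of v ∈ A with vy ∈ H, and the resulting map α : Y → X is a group homomorphism; (iii) there is a group homomorphism f̂ : Ḣ → G defined by f̂(a₀y) = f(a₀)·α(y) for a₀ ∈ A₀, y ∈ Y; in particular f̂ agrees with f on A₀ and f̂(Y) ⊆ X. -/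
/-- `y` and `x` lie in `X`, and `f` sends some element of `H ∩ Ay` into `Ax`. -/
def ComponentRel {G : Type*} [Group G] (A X H : Subgroup G) (f : H →* G) (y x : G) : Prop :=
  y ∈ X ∧ x ∈ X ∧ ∃ h : H, ∃ v ∈ A, ∃ w ∈ A, (h : G) = v * y ∧ f h = w * x

namespace ComponentRel

variable {G : Type*} [Group G] {A X H : Subgroup G} {f : H →* G}

theorem mul (hA : A.Normal) {y x y' x' : G} (hy : ComponentRel A X H f y x)
    (hy' : ComponentRel A X H f y' x') : ComponentRel A X H f (y * y') (x * x') := by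
  obtain ⟨hyX, hxX, h, v, hv, w, hw, hh, hfh⟩ := hy
  obtain ⟨hyX', hxX', h', v', hv', w', hw', hh', hfh'⟩ := hy'
  refine ⟨mul_mem hyX hyX', mul_mem hxX hxX', h * h',
    v * (y * v' * y⁻¹), mul_mem hv (hA.conj_mem _ hv' _),
    w * (x * w' * x⁻¹), mul_mem hw (hA.conj_mem _ hw' _), ?_, ?_⟩
  · rw [Subgroup.coe_mul, hh, hh']; group
  · rw [map_mul, hfh, hfh']; group

theorem inv (hA : A.Normal) {y x : G} (hy : ComponentRel A X H f y x) :
    ComponentRel A X H f y⁻¹ x⁻¹ := by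
  obtain ⟨hyX, hxX, h, v, hv, w, hw, hh, hfh⟩ := hy
  refine ⟨inv_mem hyX, inv_mem hxX, h⁻¹,
    y⁻¹ * v⁻¹ * y, hA.conj_mem' _ (inv_mem hv) _,
    x⁻¹ * w⁻¹ * x, hA.conj_mem' _ (inv_mem hw) _, ?_, ?_⟩
  · rw [Subgroup.coe_inv, hh]; group
  · rw [map_inv, hfh]; group

theorem one : ComponentRel A X H f 1 1 :=
  ⟨one_mem _, one_mem _, 1, 1, one_mem _, 1, one_mem _, by simp, by simp⟩

theorem eq_one (hAX : A ⊓ X = ⊥) (hf : ∀ h : H, (h : G) ∈ A → f h ∈ A) {x : G}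
    (hx : ComponentRel A X H f 1 x) : x = 1 := by
  obtain ⟨-, hxX, h, v, hv, w, hw, hh, hfh⟩ := hx
  have hfA : f h ∈ A := hf h (by rw [hh, mul_one]; exact hv)
  rw [hfh, A.mul_mem_cancel_left hw] at hfA
  exact Subgroup.mem_bot.1 (hAX ▸ ⟨hfA, hxX⟩)

theorem unique (hA : A.Normal) (hAX : A ⊓ X = ⊥) (hf : ∀ h : H, (h : G) ∈ A → f h ∈ A)
    {y x x' : G} (hx : ComponentRel A X H f y x) (hx' : ComponentRel A X H f y x') :
    x = x' := by
  have h := hx.mul hA (hx'.inv hA)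
  rw [mul_inv_cancel] at h
  exact mul_inv_eq_one.1 (h.eq_one hAX hf)

theorem exists_conj (hA : A.Normal) (hAab : ∀ a ∈ A, ∀ b ∈ A, a * b = b * a)
    (hf : ∀ h : H, (h : G) ∈ A → f h ∈ A) {y x : G} (hy : ComponentRel A X H f y x)
    (a : H) (ha : (a : G) ∈ A) :
    ∃ b : H, (b : G) = y * a * y⁻¹ ∧ f b = x * f a * x⁻¹ := by
  obtain ⟨-, -, h, v, hv, w, hw, hh, hfh⟩ := hy
  refine ⟨h * a * h⁻¹, ?_, ?_⟩
  · calc ((h * a * h⁻¹ : H) : G) = v * (y * a * y⁻¹) * v⁻¹ := by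
          simp only [Subgroup.coe_mul, Subgroup.coe_inv, hh]; group
      _ = y * a * y⁻¹ := by rw [hAab v hv _ (hA.conj_mem _ ha _), mul_inv_cancel_right]
  · calc f (h * a * h⁻¹) = w * (x * f a * x⁻¹) * w⁻¹ := by
          simp only [map_mul, map_inv, hfh]; group
      _ = x * f a * x⁻¹ := by
          rw [hAab w hw _ (hA.conj_mem _ (hf a ha) _), mul_inv_cancel_right]

theorem exists_of_mem (hA : A.Normal) (hG : A ⊔ X = ⊤) {y : G} (hy : y ∈ (A ⊔ H) ⊓ X) :
    ∃ x, ComponentRel A X H f y x := by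
  obtain ⟨v, hv, h, hh, rfl⟩ := Subgroup.mem_sup_of_normal_left.1 hy.1
  obtain ⟨w, hw, x, hx, hwx⟩ :=
    Subgroup.mem_sup_of_normal_left.1 (hG ▸ Subgroup.mem_top (f ⟨h, hh⟩))
  exact ⟨x, hy.2, hx, ⟨h, hh⟩, v⁻¹, inv_mem hv, w, hw, by simp, hwx.symm⟩

/-- The subgroup of pairs `(a * y, f a * x)` with `a ∈ A ∩ H` and `x` the component
of `f` attached to `y`. -/
def graph (f : H →* G) (hA : A.Normal) (hAab : ∀ a ∈ A, ∀ b ∈ A, a * b = b * a)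
    (hf : ∀ h : H, (h : G) ∈ A → f h ∈ A) (X : Subgroup G) : Subgroup (G × G) where
  carrier := {p | ∃ a : H, (a : G) ∈ A ∧ ∃ y x, ComponentRel A X H f y x ∧
    p = (a * y, f a * x)}
  one_mem' := ⟨1, one_mem _, 1, 1, one, by simp; rfl⟩
  mul_mem' := by
    rintro _ _ ⟨a, ha, y, x, hy, rfl⟩ ⟨a', ha', y', x', hy', rfl⟩
    obtain ⟨b, hb, hfb⟩ := hy.exists_conj hA hAab hf a' ha'
    have hbA : (b : G) ∈ A := hb ▸ hA.conj_mem _ ha' _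
    refine ⟨a * b, mul_mem ha hbA, y * y', x * x', hy.mul hA hy', ?_⟩
    rw [Prod.mk_mul_mk, Subgroup.coe_mul, map_mul, hb, hfb]
    congr 1 <;> group
  inv_mem' := by
    rintro _ ⟨a, ha, y, x, hy, rfl⟩
    obtain ⟨b, hb, hfb⟩ := (hy.inv hA).exists_conj hA hAab hf a⁻¹ (inv_mem ha)
    have hbA : (b : G) ∈ A := hb ▸ hA.conj_mem _ (inv_mem ha) _
    refine ⟨b, hbA, y⁻¹, x⁻¹, hy.inv hA, ?_⟩
    rw [Prod.inv_mk, hb, hfb, Subgroup.coe_inv, map_inv]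
    congr 1 <;> group

theorem eq_one_of_mem_graph (hA : A.Normal) (hAab : ∀ a ∈ A, ∀ b ∈ A, a * b = b * a)
    (hf : ∀ h : H, (h : G) ∈ A → f h ∈ A) (hAX : A ⊓ X = ⊥) {k : G}
    (hk : (1, k) ∈ graph f hA hAab hf X) : k = 1 := by
  obtain ⟨a, ha, y, x, hy, h⟩ := hk
  obtain ⟨h1, rfl⟩ := Prod.mk.inj h
  have hyA : y ∈ A := by rw [← A.mul_mem_cancel_left ha, ← h1]; exact one_mem A
  obtain rfl : y = 1 := Subgroup.mem_bot.1 (hAX ▸ ⟨hyA, hy.1⟩)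
  have ha1 : a = 1 := Subtype.ext (by simpa using h1.symm)
  rw [ha1, hy.eq_one hAX hf, map_one, mul_one]

theorem exists_hom (hA : A.Normal) (hAab : ∀ a ∈ A, ∀ b ∈ A, a * b = b * a)
    (hAX : A ⊓ X = ⊥) (hG : A ⊔ X = ⊤) (hf : ∀ h : H, (h : G) ∈ A → f h ∈ A) :
    ∃ F : ↥((A ⊓ H) ⊔ ((A ⊔ H) ⊓ X)) →* G,
      ∀ (g : ↥((A ⊓ H) ⊔ ((A ⊔ H) ⊓ X))) (k : G), ((g : G), k) ∈ graph f hA hAab hf X → F g = k := by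
  have hle : (A ⊓ H) ⊔ ((A ⊔ H) ⊓ X) ≤
      (graph f hA hAab hf X).map (MonoidHom.fst G G) := by
    refine sup_le (fun a ha ↦ ?_) fun y hy ↦ ?_
    · exact ⟨(a, f ⟨a, ha.2⟩), ⟨⟨a, ha.2⟩, ha.1, 1, 1, one, by simp⟩, rfl⟩
    · obtain ⟨x, hx⟩ := exists_of_mem (f := f) hA hG hy
      exact ⟨(y, x), ⟨1, one_mem _, y, x, hx, by simp⟩, rfl⟩
  have huniq : ∀ {g k k' : G}, (g, k) ∈ graph f hA hAab hf X →
      (g, k') ∈ graph f hA hAab hf X → k = k' := by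
    intro g k k' hk hk'
    have h := mul_mem hk (inv_mem hk')
    rw [Prod.inv_mk, Prod.mk_mul_mk, mul_inv_cancel] at h
    exact mul_inv_eq_one.1 (eq_one_of_mem_graph hA hAab hf hAX h)
  have hex : ∀ g : ↥((A ⊓ H) ⊔ ((A ⊔ H) ⊓ X)), ∃ k,
      ((g : G), k) ∈ graph f hA hAab hf X := by
    rintro ⟨g, hg⟩
    obtain ⟨⟨_, k⟩, hk, rfl⟩ := hle hg
    exact ⟨k, hk⟩
  choose F hF using hex
  exact ⟨MonoidHom.mk' F fun a b ↦ huniq (hF (a * b)) (mul_mem (hF a) (hF b)),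
    fun g k hk ↦ huniq (hF g) hk⟩

end ComponentRel

/-- With `G = A ⋊ X` internal semidirect product, `H ≤ G` of finite index,
`f : H → G` with `f(A ∩ H) ≤ A`, `A₀ = A ∩ H`, `Y = AH ∩ X`, `Ḣ = A₀Y`:
(i) every `y ∈ Y` can be corrected by some `v ∈ A` so that `vy ∈ H`;
(ii) the `X`-component of `f(vy)` does not depend on the choice of `v`, and
(iii) there is a homomorphism `f̂ : Ḣ → G` agreeing with `f` on `A₀`, mapping `Y` into `X`,
and sending each `y ∈ Y` to the `X`-component of `f(vy)`. -/
theorem stmt1 {G : Type*} [Group G] (A X : Subgroup G)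
    (hAnormal : A.Normal) (hAab : ∀ a ∈ A, ∀ b ∈ A, a * b = b * a)
    (hAX : A ⊓ X = ⊥) (hG : A ⊔ X = ⊤)
    (hcent : ∀ x ∈ X, (∀ a ∈ A, x * a = a * x) → x = 1)
    (H : Subgroup G) (hfin : H.FiniteIndex)
    (f : H →* G) (hf : ∀ h : H, (h : G) ∈ A → f h ∈ A) :
    (∀ y ∈ (A ⊔ H) ⊓ X, ∃ v ∈ A, v * y ∈ H) ∧
    (∀ y ∈ (A ⊔ H) ⊓ X, ∀ v ∈ A, ∀ v' ∈ A, ∀ (h1 : v * y ∈ H) (h2 : v' * y ∈ H),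
      ∀ w x w' x' : G, w ∈ A → x ∈ X → w' ∈ A → x' ∈ X →
        (f ⟨v * y, h1⟩ : G) = w * x → (f ⟨v' * y, h2⟩ : G) = w' * x' → x = x') ∧
    (∃ fhat : ↥((A ⊓ H) ⊔ ((A ⊔ H) ⊓ X)) →* G,
      (∀ a (ha : a ∈ A ⊓ H),
        fhat ⟨a, Subgroup.mem_sup_left ha⟩ = f ⟨a, ha.2⟩) ∧
      (∀ y (hy : y ∈ (A ⊔ H) ⊓ X),
        (fhat ⟨y, Subgroup.mem_sup_right hy⟩ : G) ∈ X) ∧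
      (∀ y (hy : y ∈ (A ⊔ H) ⊓ X), ∀ v ∈ A, ∀ (h : v * y ∈ H), ∀ w x : G,
        w ∈ A → x ∈ X → (f ⟨v * y, h⟩ : G) = w * x →
          fhat ⟨y, Subgroup.mem_sup_right hy⟩ = x) ∧
      (∀ a (ha : a ∈ A ⊓ H), ∀ y (hy : y ∈ (A ⊔ H) ⊓ X),
        fhat ⟨a * y, mul_mem (Subgroup.mem_sup_left ha) (Subgroup.mem_sup_right hy)⟩
          = f ⟨a, ha.2⟩ * fhat ⟨y, Subgroup.mem_sup_right hy⟩)) := by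
  have hrel : ∀ y ∈ X, ∀ v ∈ A, ∀ (h : v * y ∈ H), ∀ w ∈ A, ∀ x ∈ X,
      f ⟨v * y, h⟩ = w * x → ComponentRel A X H f y x :=
    fun y hy v hv h w hw x hx hfh ↦ ⟨hy, hx, ⟨v * y, h⟩, v, hv, w, hw, rfl, hfh⟩
  refine ⟨?_, ?_, ?_⟩
  · intro y hy
    obtain ⟨x, -, -, h, v, hv, -, -, hh, -⟩ :=
      ComponentRel.exists_of_mem (f := f) hAnormal hG hy
    exact ⟨v, hv, hh ▸ h.2⟩
  · intro y hy v hv v' hv' h1 h2 w x w' x' hw hx hw' hx' e e'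
    exact (hrel y hy.2 v hv h1 w hw x hx e).unique hAnormal hAX hf
      (hrel y hy.2 v' hv' h2 w' hw' x' hx' e')
  · obtain ⟨F, hF⟩ := ComponentRel.exists_hom hAnormal hAab hAX hG hf
    have hFa : ∀ a (ha : a ∈ A ⊓ H), F ⟨a, Subgroup.mem_sup_left ha⟩ = f ⟨a, ha.2⟩ :=
      fun a ha ↦ hF _ _ ⟨⟨a, ha.2⟩, ha.1, 1, 1, ComponentRel.one, by simp⟩
    have hFy : ∀ y (hy : y ∈ (A ⊔ H) ⊓ X), ∀ x, ComponentRel A X H f y x →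
        F ⟨y, Subgroup.mem_sup_right hy⟩ = x :=
      fun y hy x hx ↦ hF _ _ ⟨1, one_mem _, y, x, hx, by simp⟩
    refine ⟨F, hFa, ?_, ?_, ?_⟩
    · intro y hy
      obtain ⟨x, hx⟩ := ComponentRel.exists_of_mem (f := f) hAnormal hG hy
      rw [hFy y hy x hx]
      exact hx.2.1
    · intro y hy v hv h w x hw hx e
      exact hFy y hy x (hrel y hy.2 v hv h w hw x hx e)
    · intro a ha y hy
      rw [← hFa a ha, ← map_mul]
      rfl
end

section
/- Let G = A ⋊ X be an internal semidirect product where A is an abelian normal subgroup, X is a complement, and the centralizer of A in X is trivial. Let H ≤ G be a subgroup of finite index, f : H → G a homomorphism with f(A ∩ H) ≤ A, A₀ = A ∩ H, Y = AH ∩ X, Ḣ = A₀Y, and let f̂ : Ḣ → G be a homomorphism that agrees with f on A₀ and maps each y ∈ Y to the X-component of f(vy) for any v ∈ A with vy ∈ H. If f is simple (the only subgroup K ≤ H that is normal in G and satisfies f(K) ≤ K is trivial), then f̂ is simple (the only subgroup K ≤ Ḣ that is normal in G and satisfies f̂(K) ≤ K is trivial). -/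
/-- A homomorphism `f` defined on a subgroup `L ≤ G` is *simple* if the only subgroup `K ≤ L`
which is normal in `G` and `f`-invariant (`f(K) ≤ K`) is the trivial subgroup. -/
def SimpleOn {G : Type*} [Group G] (L : Subgroup G) (f : L →* G) : Prop :=
  ∀ (K : Subgroup G) (hKL : K ≤ L), K.Normal →
    (∀ g (hg : g ∈ K), (f ⟨g, hKL hg⟩ : G) ∈ K) → K = ⊥

/-- If `A` is abelian and normal, and `X` is disjoint from `A`, then the part of
`(A ⊓ H) ⊔ ((A ⊔ H) ⊓ X)` lying in `A` is contained in `H`. -/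
theorem inf_sup_sup_inf_le {G : Type*} [Group G] {A X : Subgroup G} [A.Normal]
    (hAab : ∀ a ∈ A, ∀ b ∈ A, a * b = b * a) (hAX : A ⊓ X = ⊥) (H : Subgroup G) :
    A ⊓ ((A ⊓ H) ⊔ ((A ⊔ H) ⊓ X)) ≤ H := by
  have hnorm : (A ⊔ H) ⊓ X ≤ Subgroup.normalizer (A ⊓ H : Subgroup G) := by
    refine inf_le_left.trans (sup_le ?_ ?_)
    · refine Subgroup.le_normalizer_iff.2 fun a ha b hb => ?_
      rwa [hAab a ha b hb.1, mul_inv_cancel_right]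
    · exact Subgroup.le_normalizer_iff.2 fun h hh b hb =>
        ⟨‹A.Normal›.conj_mem b hb.1 h, H.mul_mem (H.mul_mem hh hb.2) (H.inv_mem hh)⟩
  intro g hg
  obtain ⟨hgA, hg⟩ := Subgroup.mem_inf.1 hg
  rw [← SetLike.mem_coe, Subgroup.coe_mul_of_right_le_normalizer_left _ _ hnorm] at hg
  obtain ⟨a, ha, y, hy, rfl⟩ := hg
  have hyA : y ∈ A ⊓ X := ⟨(A.mul_mem_cancel_left ha.1).1 hgA, hy.2⟩
  rw [hAX, Subgroup.mem_bot] at hyA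
  simpa [hyA] using ha.2

/-- An abelian normal subgroup `A` with a complement `X` acting faithfully on it is
self-centralizing. -/
theorem mem_of_commute_of_sup_eq_top {G : Type*} [Group G] {A X : Subgroup G} [A.Normal]
    (hAab : ∀ a ∈ A, ∀ b ∈ A, a * b = b * a) (hG : A ⊔ X = ⊤)
    (hcent : ∀ x ∈ X, (∀ a ∈ A, x * a = a * x) → x = 1) {g : G}
    (hg : ∀ a ∈ A, Commute g a) : g ∈ A := by
  obtain ⟨w, hw, x, hx, rfl⟩ := Subgroup.mem_sup_of_normal_left.1 (hG ▸ Subgroup.mem_top g)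
  have hx1 : x = 1 := hcent x hx fun a ha => by
    have hwa : Commute w a := hAab w hw a ha
    simpa using (hwa.inv_left.mul_left (hg a ha)).eq
  simpa [hx1] using hw

/-- With `G = A ⋊ X` internal semidirect product, `H ≤ G` of finite index,
`f : H → G` with `f(A ∩ H) ≤ A`, `A₀ = A ∩ H`, `Y = AH ∩ X`, `Ḣ = A₀Y`, and `f̂ : Ḣ → G`
agreeing with `f` on `A₀` and sending each `y ∈ Y` to the `X`-component of `f(vy)`
(for any `v ∈ A` with `vy ∈ H`): if `f` is simple then `f̂` is simple. -/
theorem stmt2 {G : Type*} [Group G] (A X : Subgroup G)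
    (hAnormal : A.Normal) (hAab : ∀ a ∈ A, ∀ b ∈ A, a * b = b * a)
    (hAX : A ⊓ X = ⊥) (hG : A ⊔ X = ⊤)
    (hcent : ∀ x ∈ X, (∀ a ∈ A, x * a = a * x) → x = 1)
    (H : Subgroup G) (hfin : H.FiniteIndex)
    (f : H →* G) (hf : ∀ h : H, (h : G) ∈ A → f h ∈ A)
    (fhat : ↥((A ⊓ H) ⊔ ((A ⊔ H) ⊓ X)) →* G)
    (hagree : ∀ a (ha : a ∈ A ⊓ H),
      fhat ⟨a, Subgroup.mem_sup_left ha⟩ = f ⟨a, ha.2⟩)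
    (hcomp : ∀ y (hy : y ∈ (A ⊔ H) ⊓ X), ∀ v ∈ A, ∀ (h : v * y ∈ H), ∀ w x : G,
      w ∈ A → x ∈ X → (f ⟨v * y, h⟩ : G) = w * x →
        fhat ⟨y, Subgroup.mem_sup_right hy⟩ = x)
    (hsimple : SimpleOn H f) :
    SimpleOn ((A ⊓ H) ⊔ ((A ⊔ H) ⊓ X)) fhat := by
  intro K hK hKnormal hKinv
  have hinf : A ⊓ K = ⊥ := by
    have hle : A ⊓ K ≤ H :=
      (inf_le_inf_left A hK).trans (inf_sup_sup_inf_le hAab hAX H)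
    refine hsimple (A ⊓ K) hle inferInstance fun g hg => ⟨hf _ hg.1, ?_⟩
    rw [← hagree g ⟨hg.1, hle hg⟩]
    exact hKinv g hg.2
  have hKA : K ≤ A := fun g hg =>
    mem_of_commute_of_sup_eq_top hAab hG hcent fun a ha =>
      Subgroup.commute_of_normal_of_disjoint K A hKnormal hAnormal
        (disjoint_iff.2 (inf_comm A K ▸ hinf)) g a hg ha
  rwa [inf_eq_right.2 hKA] at hinf
end

section
/- Let G = A ⋊ X be an internal semidirect product where A is an abelian normal subgroup, X is a complement, and the centralizer of A in X is trivial. Let H ≤ G be a subgroup, f : H → G a homomorphism with f(A ∩ H) ≤ A, and suppose A₀ = A ∩ H is normal in G. If every subgroup K ≤ H that is normal in G and satisfies f(K) ≤ K has K ∩ A = 1, then f is simple: every subgroup K ≤ H that is normal in G and satisfies f(K) ≤ K is trivial. -/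
/-- If `A` is abelian, `A X = G` and only the identity of `X` centralizes `A`, then `A` is
self-centralizing. -/
theorem mem_of_forall_commute_of_sup_eq_top {G : Type*} [Group G] {A X : Subgroup G}
    (hA : A.Normal) (hAab : ∀ a ∈ A, ∀ b ∈ A, a * b = b * a) (hG : A ⊔ X = ⊤)
    (hcent : ∀ x ∈ X, (∀ a ∈ A, x * a = a * x) → x = 1)
    {g : G} (hg : ∀ a ∈ A, Commute g a) : g ∈ A := by
  obtain ⟨b, hb, x, hx, rfl⟩ := Subgroup.mem_sup_of_normal_left.mp (hG ▸ Subgroup.mem_top g)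
  have hx1 : x = 1 := hcent x hx fun a ha => by
    have h : Commute (b⁻¹ * (b * x)) a :=
      (show Commute b a from hAab b hb a ha).inv_left.mul_left (hg a ha)
    rwa [inv_mul_cancel_left] at h
  simpa [hx1] using hb

/-- Let `G = A ⋊ X` be an internal semidirect product with `A` abelian normal,
`X` a complement with trivial centralizer of `A` in `X`.  Let `H ≤ G`, `f : H → G` with
`f(A ∩ H) ≤ A`, and suppose `A₀ = A ∩ H` is normal in `G`.  If every subgroup `K ≤ H` which is
normal in `G` and `f`-invariant satisfies `K ∩ A = 1`, then `f` is simple. -/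
theorem stmt3 {G : Type*} [Group G] (A X : Subgroup G)
    (hAnormal : A.Normal) (hAab : ∀ a ∈ A, ∀ b ∈ A, a * b = b * a)
    (hAX : A ⊓ X = ⊥) (hG : A ⊔ X = ⊤)
    (hcent : ∀ x ∈ X, (∀ a ∈ A, x * a = a * x) → x = 1)
    (H : Subgroup G)
    (f : H →* G) (hf : ∀ h : H, (h : G) ∈ A → f h ∈ A)
    (hA0 : (A ⊓ H).Normal)
    (hyp : ∀ (K : Subgroup G) (hKL : K ≤ H), K.Normal →
      (∀ g (hg : g ∈ K), (f ⟨g, hKL hg⟩ : G) ∈ K) → K ⊓ A = ⊥) :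
    SimpleOn H f := by
  intro K hKL hK hKf
  have hKA : K ⊓ A = ⊥ := hyp K hKL hK hKf
  have hle : K ≤ A := fun g hg =>
    mem_of_forall_commute_of_sup_eq_top hAnormal hAab hG hcent fun a ha =>
      Subgroup.commute_of_normal_of_disjoint K A hK hAnormal (disjoint_iff.mpr hKA) g a hg ha
  rwa [inf_eq_left.mpr hle] at hKA
end

section
/- Let k be a field, X a free abelian group of finite rank, A = k[X] its group algebra (an integral domain), Y ≤ X a subgroup, B = k[Y] the corresponding subalgebra of A, and α : Y → X a group homomorphism, extended to a k-algebra homomorphism α : B → A. Let I be a nonzero ideal of A and μ : I → A a k-linear map satisfying μ(w·ν) = α(w)·μ(ν) for all w ∈ B and ν ∈ I. If the only ideal J of A with J ⊆ I and μ(J) ⊆ J is the zero ideal, then α : Y → X is injective. -/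
/-- Let `k` be a field, `X` a free abelian group of finite rank (realized as
`Multiplicative (Fin d →₀ ℤ)`), `A = k[X]` its group algebra, `Y ≤ X` a subgroup and
`α : Y → X` a group homomorphism (its `k`-algebra extension `B = k[Y] → A` is determined by
its values on group elements of `Y`).  Let `I ≠ 0` be an ideal of `A` and `μ : I → A` a
`k`-linear map with `μ(w·ν) = α(w)·μ(ν)` for all `w ∈ B`, `ν ∈ I` (by `k`-linearity this is
equivalent to the displayed condition for group elements `y ∈ Y`).  If the only μ-invariant
ideal of `A` contained in `I` is zero, then `α` is injective. -/
theorem stmt4 {k : Type*} [Field k] (d : ℕ)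
    (Y : Subgroup (Multiplicative (Fin d →₀ ℤ)))
    (α : Y →* Multiplicative (Fin d →₀ ℤ))
    (I : Ideal (MonoidAlgebra k (Multiplicative (Fin d →₀ ℤ)))) (hI : I ≠ ⊥)
    (μ : ↥I →ₗ[k] MonoidAlgebra k (Multiplicative (Fin d →₀ ℤ)))
    (hskew : ∀ (y : Y) (ν : ↥I),
      μ ⟨MonoidAlgebra.of k (Multiplicative (Fin d →₀ ℤ)) (y : Multiplicative (Fin d →₀ ℤ))
            * (ν : MonoidAlgebra k (Multiplicative (Fin d →₀ ℤ))),
          I.mul_mem_left _ ν.2⟩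
        = MonoidAlgebra.of k (Multiplicative (Fin d →₀ ℤ)) (α y) * μ ν)
    (hsimple : ∀ (J : Ideal (MonoidAlgebra k (Multiplicative (Fin d →₀ ℤ))))
      (hJ : J ≤ I), (∀ a (ha : a ∈ J), μ ⟨a, hJ ha⟩ ∈ J) → J = ⊥) :
    Function.Injective α := by
  rw [injective_iff_map_eq_one]
  intro y hy
  have hle : Ideal.span {MonoidAlgebra.of k _ (y : Multiplicative (Fin d →₀ ℤ)) - 1} * I ≤ I :=
    Ideal.mul_le_right
  have hbot := hsimple _ hle fun a ha => by
    obtain ⟨ν, hν, rfl⟩ := Ideal.mem_span_singleton_mul.mp ha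
    have hsub : (⟨_, hle ha⟩ : I) = ⟨_, I.mul_mem_left (MonoidAlgebra.of k _ y.1) hν⟩ - ⟨ν, hν⟩ :=
      Subtype.ext (by simp [sub_mul])
    have hzero := hskew y ⟨ν, hν⟩
    rw [hy, map_one, one_mul] at hzero
    rw [hsub, map_sub, hzero, sub_self]
    exact zero_mem _
  have : UniqueSums (Fin d →₀ ℤ) :=
    UniqueSums.of_injective_addHom Finsupp.coeFnAddHom.toAddHom DFunLike.coe_injective inferInstance
  rcases Ideal.mul_eq_bot.mp hbot with h | h
  · rw [Ideal.span_singleton_eq_bot, sub_eq_zero, ← map_one (MonoidAlgebra.of k _)] at h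
    exact Subtype.ext (MonoidAlgebra.of_injective h)
  · exact absurd h hI
end

section
/- Let K be a field, n ≥ 2 an integer, v a nonzero integer, and M = (m_{ij}) an n×n integer matrix with determinant t. Suppose u₁, …, u_n are elements of the Laurent polynomial ring K[x₁^{±1}, …, x_n^{±1}] satisfying (x₁^{v m_{i1}} x₂^{v m_{i2}} ⋯ x_n^{v m_{in}} − 1)·u_j = (x₁^{v m_{j1}} x₂^{v m_{j2}} ⋯ x_n^{v m_{jn}} − 1)·u_i for all 1 ≤ i < j ≤ n. Then either t = 0 or u_i lies in the ideal generated by x₁^v − 1, x₂^v − 1, …, x_n^v − 1 for every i. -/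
/-- The monomial `x₁^{v 1} ⋯ x_n^{v n}` in the Laurent polynomial ring in `n` variables over `K`,
realized as the group algebra of the free abelian group `Fin n →₀ ℤ`. -/
noncomputable def mono (K : Type*) [CommSemiring K] (n : ℕ) (v : Fin n →₀ ℤ) :
    MonoidAlgebra K (Multiplicative (Fin n →₀ ℤ)) :=
  MonoidAlgebra.of K (Multiplicative (Fin n →₀ ℤ)) (Multiplicative.ofAdd v)

/-- In a group algebra, `q - 1` is not a left zero divisor if `q` has infinite order. -/
lemma MonoidAlgebra.eq_zero_of_of_mul_eq_self {R H : Type*} [Semiring R] [Group H] {q : H}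
    (hq : ¬IsOfFinOrder q) {f : MonoidAlgebra R H} (hf : MonoidAlgebra.of R H q * f = f) :
    f = 0 := by
  by_contra hne
  obtain ⟨x, hx⟩ : ∃ x, f.coeff x ≠ 0 := by
    by_contra! h
    exact hne (MonoidAlgebra.ext (Finsupp.ext h))
  have hstep (y : H) : f.coeff (q * y) = f.coeff y := by
    conv_lhs => rw [← hf]
    simp [MonoidAlgebra.of_apply]
  have hpow (k : ℕ) : f.coeff (q ^ k * x) = f.coeff x := by
    induction k with
    | zero => simp
    | succ k ih => rw [pow_succ', mul_assoc, hstep, ih]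
  refine Set.infinite_of_injective_forall_mem (f := fun k : ℕ => q ^ k * x) ?_ (fun k => ?_)
    f.coeff.support.finite_toSet
  · exact (mul_left_injective x).comp (injective_pow_iff_not_isOfFinOrder.mpr hq)
  · simpa [hpow] using hx

/-- The kernel of `R[G] → R[G ⧸ ⟨g⟩]` is generated by `g - 1`. -/
lemma MonoidAlgebra.of_sub_one_dvd_of_mapDomain_eq_zero {R G : Type*} [CommRing R] [CommGroup G]
    {g : G} {f : MonoidAlgebra R G}
    (hf : MonoidAlgebra.mapDomainAlgHom R R (QuotientGroup.mk' (Subgroup.zpowers g)) f = 0) :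
    MonoidAlgebra.of R G g - 1 ∣ f := by
  let I : Ideal (MonoidAlgebra R G) := Ideal.span {MonoidAlgebra.of R G g - 1}
  let φ : G →* MonoidAlgebra R G ⧸ I :=
    (Ideal.Quotient.mk I : MonoidAlgebra R G →* MonoidAlgebra R G ⧸ I).comp (MonoidAlgebra.of R G)
  have hφ : Subgroup.zpowers g ≤ φ.ker := by
    rw [Subgroup.zpowers_le, MonoidHom.mem_ker]
    change Ideal.Quotient.mk I (MonoidAlgebra.of R G g) = Ideal.Quotient.mk I 1
    exact Ideal.Quotient.eq.mpr (Ideal.mem_span_singleton_self _)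
  let ψ := MonoidAlgebra.lift R (MonoidAlgebra R G ⧸ I) _
    (QuotientGroup.lift (Subgroup.zpowers g) φ hφ)
  have hcomp : ψ.comp (MonoidAlgebra.mapDomainAlgHom R R
      (QuotientGroup.mk' (Subgroup.zpowers g))) = Ideal.Quotient.mkₐ R I := by
    ext x
    simp [ψ, φ]
  rw [← Ideal.mem_span_singleton, ← Ideal.Quotient.eq_zero_iff_mem]
  have := DFunLike.congr_fun hcomp f
  rw [AlgHom.comp_apply, hf, map_zero] at this
  exact this.symm

/-- If `h` has infinite order modulo `⟨g⟩`, then `h - 1` is a nonzerodivisor modulo `g - 1`. -/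
lemma MonoidAlgebra.of_sub_one_dvd_of_dvd_mul {R G : Type*} [CommRing R] [CommGroup G] {g h : G}
    (hgh : ¬IsOfFinOrder (h : G ⧸ Subgroup.zpowers g)) {f : MonoidAlgebra R G}
    (hf : MonoidAlgebra.of R G g - 1 ∣ (MonoidAlgebra.of R G h - 1) * f) :
    MonoidAlgebra.of R G g - 1 ∣ f := by
  apply MonoidAlgebra.of_sub_one_dvd_of_mapDomain_eq_zero
  apply MonoidAlgebra.eq_zero_of_of_mul_eq_self hgh
  obtain ⟨c, hc⟩ := hf
  have hg : ((g : G) : G ⧸ Subgroup.zpowers g) = 1 :=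
    (QuotientGroup.eq_one_iff g).mpr (Subgroup.mem_zpowers g)
  have := congrArg (MonoidAlgebra.mapDomainAlgHom R R
    (QuotientGroup.mk' (Subgroup.zpowers g))) hc
  simp only [map_mul, map_sub, map_one] at this
  simpa [sub_mul, sub_eq_zero, hg, ← MonoidAlgebra.one_def] using this

lemma mono_sub_one_mem_span (K : Type*) [CommRing K] (n : ℕ) (v : ℤ) (m : Fin n → ℤ) :
    mono K n (Finsupp.equivFunOnFinite.symm fun l => v * m l) - 1 ∈
      Ideal.span {g : MonoidAlgebra K (Multiplicative (Fin n →₀ ℤ)) |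
        ∃ l : Fin n, g = mono K n (Finsupp.single l v) - 1} := by
  set I := Ideal.span {g : MonoidAlgebra K (Multiplicative (Fin n →₀ ℤ)) |
        ∃ l : Fin n, g = mono K n (Finsupp.single l v) - 1}
  let φ : Multiplicative (Fin n →₀ ℤ) →* MonoidAlgebra K (Multiplicative (Fin n →₀ ℤ)) ⧸ I :=
    (Ideal.Quotient.mk I : _ →* _).comp (MonoidAlgebra.of K _)
  have hmem (w : Fin n →₀ ℤ) : mono K n w - 1 ∈ I ↔ Multiplicative.ofAdd w ∈ φ.ker := by
    rw [MonoidHom.mem_ker, ← Ideal.Quotient.eq]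
    rfl
  have hw : Multiplicative.ofAdd (Finsupp.equivFunOnFinite.symm fun l => v * m l) =
      ∏ l, Multiplicative.ofAdd (Finsupp.single l v) ^ m l := by
    simp_rw [← ofAdd_zsmul, ← ofAdd_sum]
    congr 1
    ext l
    simp [Finsupp.finsetSum_apply, Finsupp.single_apply, mul_comm]
  rw [hmem, hw]
  refine Subgroup.prod_mem _ fun l _ => Subgroup.zpow_mem _ ?_ _
  exact (hmem _).mp (Ideal.subset_span ⟨l, rfl⟩)

lemma not_isOfFinOrder_row_of_det_ne_zero {n : ℕ} {v : ℤ} (hv : v ≠ 0)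
    {M : Matrix (Fin n) (Fin n) ℤ} (hM : M.det ≠ 0) {i j : Fin n} (hij : i ≠ j) :
    ¬IsOfFinOrder
      ((Multiplicative.ofAdd (Finsupp.equivFunOnFinite.symm fun l => v * M j l) :
          Multiplicative (Fin n →₀ ℤ)) :
        Multiplicative (Fin n →₀ ℤ) ⧸ Subgroup.zpowers
          (Multiplicative.ofAdd (Finsupp.equivFunOnFinite.symm fun l => v * M i l))) := by
  rw [isOfFinOrder_iff_pow_eq_one]
  rintro ⟨k, hk, h⟩
  rw [← QuotientGroup.mk_pow, QuotientGroup.eq_one_iff, Subgroup.mem_zpowers_iff] at h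
  obtain ⟨c, hc⟩ := h
  rw [← ofAdd_zsmul, ← ofAdd_nsmul] at hc
  have hc' (l : Fin n) : c * M i l = k * M j l := by
    have := DFunLike.congr_fun (Multiplicative.ofAdd.injective hc) l
    simp at this
    apply mul_left_cancel₀ hv
    linear_combination this
  have hzero := Matrix.eq_zero_of_vecMul_eq_zero hM
    (v := Pi.single j (k : ℤ) - Pi.single i c) (by
      ext l
      simp [Matrix.sub_vecMul, Matrix.single_vecMul, hc'])
  have := congrFun hzero j
  simp [hij.symm] at this
  omega

/-- Let `K` be a field, `n ≥ 2`, `v ≠ 0` an integer, `M` an `n×n` integer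
matrix with determinant `t`, and `u₁, …, u_n` Laurent polynomials satisfying
`(x₁^{v m_{i1}} ⋯ x_n^{v m_{in}} − 1)·u_j = (x₁^{v m_{j1}} ⋯ x_n^{v m_{jn}} − 1)·u_i` for all
`i < j`.  Then either `t = 0` or every `u_i` lies in the ideal `(x₁^v − 1, …, x_n^v − 1)`. -/
theorem stmt5 {K : Type*} [Field K] (n : ℕ) (hn : 2 ≤ n) (v : ℤ) (hv : v ≠ 0)
    (M : Matrix (Fin n) (Fin n) ℤ)
    (u : Fin n → MonoidAlgebra K (Multiplicative (Fin n →₀ ℤ)))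
    (hrel : ∀ i j : Fin n, i < j →
      (mono K n (Finsupp.equivFunOnFinite.symm fun l => v * M i l) - 1) * u j
        = (mono K n (Finsupp.equivFunOnFinite.symm fun l => v * M j l) - 1) * u i) :
    M.det = 0 ∨ ∀ i : Fin n,
      u i ∈ Ideal.span {g : MonoidAlgebra K (Multiplicative (Fin n →₀ ℤ)) |
        ∃ l : Fin n, g = mono K n (Finsupp.single l v) - 1} := by
  refine or_iff_not_imp_left.mpr fun hM i => ?_
  have : Nontrivial (Fin n) := Fin.nontrivial_iff_two_le.mpr hn
  obtain ⟨j, hji⟩ := exists_ne i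
  obtain ⟨c, hc⟩ := MonoidAlgebra.of_sub_one_dvd_of_dvd_mul (f := u i)
    (not_isOfFinOrder_row_of_det_ne_zero hv hM hji.symm) ⟨u j, by
      rcases lt_or_gt_of_ne hji with h | h
      · exact hrel j i h
      · exact (hrel i j h).symm⟩
  rw [hc]
  exact Ideal.mul_mem_right _ _ (mono_sub_one_mem_span K n v (M i))
end

section
/- Let K be a field, v a nonzero integer, and m₁₁, m₁₂, m₂₁, m₂₂ integers with m₁₁m₂₂ − m₁₂m₂₁ ≠ 0. Then in the Laurent polynomial ring K[x₁^{±1}, x₂^{±1}], every common divisor of x₁^{v m₁₁} x₂^{v m₁₂} − 1 and x₁^{v m₂₁} x₂^{v m₂₂} − 1 is a unit. -/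
open MonoidAlgebra in
/-- In a product of nonzero elements of a monoid algebra, the product of the monomials that are
maximal for an ordering compatible with multiplication does not cancel. -/
theorem MonoidAlgebra.exists_max_mul_mem_support {R G Γ : Type*} [Semiring R] [NoZeroDivisors R]
    [Mul G] [AddCommMonoid Γ] [LinearOrder Γ] [IsOrderedCancelAddMonoid Γ] (D : G → Γ)
    (hD : Function.Injective D) (hmul : ∀ x y, D (x * y) = D x + D y)
    {g h : MonoidAlgebra R G} (hg : g ≠ 0) (hh : h ≠ 0) :
    ∃ a b, (∀ x ∈ g.coeff.support, D x ≤ D a) ∧ (∀ y ∈ h.coeff.support, D y ≤ D b) ∧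
      a ∈ g.coeff.support ∧ b ∈ h.coeff.support ∧ a * b ∈ (g * h).coeff.support := by
  simp only [ne_eq, ← coeff_eq_zero, ← Finsupp.support_nonempty_iff] at hg hh
  obtain ⟨a, ha, ha'⟩ := Finset.exists_max_image _ D hg
  obtain ⟨b, hb, hb'⟩ := Finset.exists_max_image _ D hh
  refine ⟨a, b, ha', hb', ha, hb, ?_⟩
  have hu : UniqueMul g.coeff.support h.coeff.support a b := by
    intro x y hx hy hxy
    have e : D x + D y = D a + D b := by rw [← hmul, ← hmul, hxy]
    obtain ⟨h₁, h₂⟩ := (add_eq_add_iff_eq_and_eq (ha' x hx) (hb' y hy)).1 e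
    exact ⟨hD h₁, hD h₂⟩
  rw [Finsupp.mem_support_iff] at ha hb ⊢
  rw [coeff_mul_mul_of_uniqueMul hu]
  exact mul_ne_zero ha hb

/-- If the monomials of a nonzero product `g * h` all lie in the kernel of a linear form `ℓ`,
then `ℓ` is constant on the monomials of `g`. -/
theorem MonoidAlgebra.eq_of_mem_support_of_mul {R A : Type*} [Semiring R] [NoZeroDivisors R]
    [AddCommGroup A] (ℓ ℓ' : A →+ ℤ) (hinj : ∀ x, ℓ x = 0 → ℓ' x = 0 → x = 0)
    {g h : MonoidAlgebra R (Multiplicative A)} (hgh : g * h ≠ 0)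
    (hker : ∀ z ∈ (g * h).coeff.support, ℓ z.toAdd = 0) :
    ∀ x ∈ g.coeff.support, ∀ y ∈ g.coeff.support, ℓ x.toAdd = ℓ y.toAdd := by
  have hg : g ≠ 0 := left_ne_zero_of_mul hgh
  have hh : h ≠ 0 := right_ne_zero_of_mul hgh
  have key (f f' : A →+ ℤ) (hf : ∀ x, f x = 0 → f' x = 0 → x = 0)
      (hf0 : ∀ z ∈ (g * h).coeff.support, f z.toAdd = 0) :
      ∃ a ∈ g.coeff.support, ∃ b ∈ h.coeff.support,
        (∀ x ∈ g.coeff.support, f x.toAdd ≤ f a.toAdd) ∧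
        (∀ y ∈ h.coeff.support, f y.toAdd ≤ f b.toAdd) ∧ f a.toAdd + f b.toAdd = 0 := by
    obtain ⟨a, b, ha', hb', ha, hb, hab⟩ := exists_max_mul_mem_support
      (fun x : Multiplicative A ↦ toLex (f x.toAdd, f' x.toAdd))
      (fun x y hxy ↦ by
        have hxy' := Prod.ext_iff.1 (toLex.injective hxy)
        refine Multiplicative.toAdd.injective (sub_eq_zero.1 (hf _ ?_ ?_))
        · rw [map_sub, sub_eq_zero]; exact hxy'.1
        · rw [map_sub, sub_eq_zero]; exact hxy'.2)
      (fun x y ↦ by simp only [toAdd_mul, map_add]; rfl) hg hh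
    refine ⟨a, ha, b, hb, fun x hx ↦ ?_, fun y hy ↦ ?_, ?_⟩
    · exact Prod.Lex.monotone_fst _ _ (ha' x hx)
    · exact Prod.Lex.monotone_fst _ _ (hb' y hy)
    · simpa using hf0 _ hab
  obtain ⟨a, ha, b, hb, ha', hb', hab⟩ := key ℓ ℓ' hinj hker
  obtain ⟨c, hc, d, hd, hc', hd', hcd⟩ := key (-ℓ) (-ℓ') (by simpa using hinj) (by simpa using hker)
  simp only [AddMonoidHom.neg_apply] at hc' hd' hcd
  intro x hx y hy
  linarith [ha' x hx, ha' y hy, hc' x hx, hc' y hy, hb' d hd, ha' c hc]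

/-- A nonzero element of a monoid algebra over a group is a unit if it has a single monomial. -/
theorem MonoidAlgebra.isUnit_of_support_subsingleton {K G : Type*} [DivisionRing K] [Group G]
    {g : MonoidAlgebra K G} (hg : g ≠ 0)
    (h : ∀ x ∈ g.coeff.support, ∀ y ∈ g.coeff.support, x = y) : IsUnit g := by
  have hne := hg
  simp only [ne_eq, ← coeff_eq_zero, ← Finsupp.support_nonempty_iff] at hne
  obtain ⟨a, ha⟩ := hne
  have hs : g = single a (g.coeff a) := coeff_injective <|
    Finsupp.support_subset_singleton.1 fun x hx ↦ Finset.mem_singleton.2 (h x hx a ha)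
  have ha0 := Finsupp.mem_support_iff.1 ha
  rw [hs]
  refine ⟨⟨single a (g.coeff a), single a⁻¹ (g.coeff a)⁻¹, ?_, ?_⟩, rfl⟩ <;>
    simp [single_mul_single, ha0, one_def]

/-- The monomials of `x ^ a - 1` are among `x ^ a` and `1`. -/
theorem eq_or_eq_of_mem_support_mono_sub_one {K : Type*} [CommRing K] {n : ℕ} {a : Fin n →₀ ℤ}
    {z : Multiplicative (Fin n →₀ ℤ)} (hz : z ∈ (mono K n a - 1).coeff.support) :
    z.toAdd = a ∨ z.toAdd = 0 := by
  contrapose! hz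
  have h₁ : Multiplicative.ofAdd a ≠ z := fun h ↦ hz.1 (by rw [← h, toAdd_ofAdd])
  have h₂ : 1 ≠ z := fun h ↦ hz.2 (by rw [← h, toAdd_one])
  simp [mono, MonoidAlgebra.one_def, h₁, h₂]

/-- The Laurent polynomial `x ^ a - 1` is nonzero for `a ≠ 0`. -/
theorem mono_sub_one_ne_zero {K : Type*} [CommRing K] [Nontrivial K] {n : ℕ} {a : Fin n →₀ ℤ}
    (ha : a ≠ 0) : mono K n a - 1 ≠ 0 := by
  rw [sub_ne_zero, mono, ← map_one (MonoidAlgebra.of K _)]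
  exact fun h ↦ ha (Multiplicative.ofAdd.injective (MonoidAlgebra.of_injective h))

/-- The linear form `c ↦ a₀ c₁ - a₁ c₀` on `ℤ²`. -/
def detForm (a : Fin 2 →₀ ℤ) : (Fin 2 →₀ ℤ) →+ ℤ where
  toFun c := a 0 * c 1 - a 1 * c 0
  map_zero' := by simp
  map_add' x y := by simp only [Finsupp.add_apply]; ring

theorem detForm_apply (a c : Fin 2 →₀ ℤ) : detForm a c = a 0 * c 1 - a 1 * c 0 := rfl

theorem eq_zero_of_detForm_eq_zero {a b : Fin 2 →₀ ℤ} (hab : detForm a b ≠ 0) {x : Fin 2 →₀ ℤ}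
    (ha : detForm a x = 0) (hb : detForm b x = 0) : x = 0 := by
  rw [detForm_apply] at *
  have h₀ : (a 0 * b 1 - a 1 * b 0) * x 0 = 0 := by linear_combination b 0 * ha - a 0 * hb
  have h₁ : (a 0 * b 1 - a 1 * b 0) * x 1 = 0 := by linear_combination b 1 * ha - a 1 * hb
  ext i
  fin_cases i
  · exact (mul_eq_zero.1 h₀).resolve_left hab
  · exact (mul_eq_zero.1 h₁).resolve_left hab

/-- The form `detForm a` is constant on the monomials of a divisor of `x ^ a - 1`. -/
theorem detForm_eq_of_dvd_mono_sub_one {K : Type*} [Field K] {a b : Fin 2 →₀ ℤ}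
    (hab : detForm a b ≠ 0) {g : MonoidAlgebra K (Multiplicative (Fin 2 →₀ ℤ))}
    (h : g ∣ mono K 2 a - 1) :
    ∀ x ∈ g.coeff.support, ∀ y ∈ g.coeff.support,
      detForm a x.toAdd = detForm a y.toAdd := by
  obtain ⟨k, hk⟩ := h
  have ha : a ≠ 0 := by
    rintro rfl
    simp [detForm_apply] at hab
  refine MonoidAlgebra.eq_of_mem_support_of_mul (detForm a) (detForm b)
    (fun x ↦ eq_zero_of_detForm_eq_zero hab) (h := k) (hk ▸ mono_sub_one_ne_zero ha) ?_
  intro z hz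
  rw [← hk] at hz
  obtain h | h := eq_or_eq_of_mem_support_mono_sub_one hz
  · rw [h, detForm_apply]; ring
  · rw [h, map_zero]

/-- If `a` and `b` are linearly independent, every common divisor of `x ^ a - 1` and `x ^ b - 1` is
a unit. -/
theorem isUnit_of_dvd_mono_sub_one {K : Type*} [Field K] {a b : Fin 2 →₀ ℤ}
    (hab : detForm a b ≠ 0) {g : MonoidAlgebra K (Multiplicative (Fin 2 →₀ ℤ))}
    (h₁ : g ∣ mono K 2 a - 1) (h₂ : g ∣ mono K 2 b - 1) : IsUnit g := by
  have hba : detForm b a ≠ 0 := by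
    rw [detForm_apply] at *
    exact fun h ↦ hab (by linear_combination -h)
  have ha : a ≠ 0 := by
    rintro rfl
    simp [detForm_apply] at hab
  refine MonoidAlgebra.isUnit_of_support_subsingleton
    (ne_zero_of_dvd_ne_zero (mono_sub_one_ne_zero ha) h₁) fun x hx y hy ↦ ?_
  refine Multiplicative.toAdd.injective (sub_eq_zero.1 (eq_zero_of_detForm_eq_zero hab ?_ ?_))
  · rw [map_sub, detForm_eq_of_dvd_mono_sub_one hab h₁ x hx y hy, sub_self]
  · rw [map_sub, detForm_eq_of_dvd_mono_sub_one hba h₂ x hx y hy, sub_self]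

/-- Let `K` be a field, `v ≠ 0` an integer, and `m₁₁, m₁₂, m₂₁, m₂₂` integers
with `m₁₁m₂₂ − m₁₂m₂₁ ≠ 0`.  Then in the two-variable Laurent polynomial ring every common
divisor of `x₁^{v m₁₁} x₂^{v m₁₂} − 1` and `x₁^{v m₂₁} x₂^{v m₂₂} − 1` is a unit. -/
theorem stmt6 {K : Type*} [Field K] (v : ℤ) (hv : v ≠ 0)
    (m11 m12 m21 m22 : ℤ) (hdet : m11 * m22 - m12 * m21 ≠ 0)
    (g : MonoidAlgebra K (Multiplicative (Fin 2 →₀ ℤ)))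
    (h1 : g ∣ mono K 2 (Finsupp.single 0 (v * m11) + Finsupp.single 1 (v * m12)) - 1)
    (h2 : g ∣ mono K 2 (Finsupp.single 0 (v * m21) + Finsupp.single 1 (v * m22)) - 1) :
    IsUnit g := by
  refine isUnit_of_dvd_mono_sub_one ?_ h1 h2
  have h := mul_ne_zero (mul_ne_zero hv hv) hdet
  simp only [detForm_apply, Finsupp.add_apply, Finsupp.single_apply]
  norm_num
  exact fun h' ↦ h (by linear_combination h')
end

section
/- Let p be a prime, k = GF(p), d ≥ 2 an integer, X a free abelian group of rank d, and A = k[X] its group algebra. Let I be an ideal of A with I ≠ A such that the quotient A/I is finite. Let α : X → X be a group endomorphism, extended to a k-algebra endomorphism α : A → A, and let μ : I → A be a k-linear map satisfying the skew condition μ(r·ν) = α(r)·μ(ν) for all r ∈ A and ν ∈ I. Then there exists a nonzero ideal J of A with J ⊆ I and μ(J) ⊆ J. -/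
namespace MonoidAlgebra

variable {k G : Type*} [CommRing k] [CommGroup G]

/-- If `v` has infinite order, then `v - 1` is not a zero divisor in the group algebra. -/
theorem eq_zero_of_of_sub_one_mul_eq_zero {v : G} (hv : ¬ IsOfFinOrder v)
    {f : MonoidAlgebra k G} (hf : (of k G v - 1) * f = 0) : f = 0 := by
  have hvf : of k G v * f = f := by rwa [sub_mul, one_mul, sub_eq_zero] at hf
  have hpow : ∀ (n : ℕ) (g : G), f.coeff (v ^ n * g) = f.coeff g := by
    intro n
    induction n with
    | zero => simp
    | succ n ih =>
      intro g
      have hstep : ∀ g, f.coeff (v * g) = f.coeff g := fun g ↦ by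
        conv_lhs => rw [← hvf, of_apply, coeff_single_mul_apply]
        simp
      rw [pow_succ', mul_assoc, hstep, ih]
  ext g
  by_contra hg
  refine Set.infinite_range_of_injective (f := fun n : ℕ ↦ v ^ n * g) ?_
    (f.coeff.support.finite_toSet.subset ?_)
  · exact (mul_left_injective g).comp (injective_pow_iff_not_isOfFinOrder.2 hv)
  · rintro _ ⟨n, rfl⟩
    simpa [hpow] using hg

/-- An element of the group algebra of `G` that vanishes in the group algebra of `G ⧸ ⟨u⟩` is
divisible by `u - 1`. -/
theorem of_sub_one_dvd_of_mapDomain_eq_zero_s7 {u : G} {f : MonoidAlgebra k G}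
    (hf : mapDomain (QuotientGroup.mk' (Subgroup.zpowers u)) f = 0) : of k G u - 1 ∣ f := by
  set π := QuotientGroup.mk' (Subgroup.zpowers u)
  set K := Ideal.span {of k G u - 1}
  have hK : ∀ g ∈ Subgroup.zpowers u, of k G g - 1 ∈ K := by
    let φ : G →* MonoidAlgebra k G ⧸ K := (Ideal.Quotient.mk K).toMonoidHom.comp (of k G)
    have hφ : ∀ g, g ∈ φ.ker ↔ of k G g - 1 ∈ K := fun g ↦ by
      rw [MonoidHom.mem_ker, ← Ideal.Quotient.mk_eq_mk_iff_sub_mem]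
      rfl
    intro g hg
    rw [← hφ]
    refine (Subgroup.zpowers_le.2 ?_) hg
    rw [hφ]
    exact Ideal.mem_span_singleton_self _
  have hsec : ∀ f : MonoidAlgebra k G, f - mapDomain Quotient.out (mapDomain π f) ∈ K := by
    intro f
    induction f using induction_linear with
    | zero => simp
    | add x y hx hy =>
      rw [mapDomain_add, mapDomain_add, add_sub_add_comm]
      exact K.add_mem hx hy
    | single g r =>
      rw [mapDomain_single, mapDomain_single]
      obtain ⟨w, hw⟩ := QuotientGroup.mk_out_eq_mul (Subgroup.zpowers u) g
      have hout : Quotient.out (π g) = g * w := hw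
      have hfactor : single g r - single (g * (w : G)) r
          = -single g r * (of k G (w : G) - 1) := by
        rw [neg_mul, mul_sub, of_apply, single_mul_single]
        simp
      rw [hout, hfactor]
      exact K.mul_mem_left _ (hK _ w.2)
  rw [← Ideal.mem_span_singleton]
  have h := hsec f
  rwa [hf, mapDomain_zero, sub_zero] at h

/-- If `v` has infinite order modulo `⟨u⟩`, then `u - 1` and `v - 1` are relatively prime. -/
theorem of_sub_one_dvd_of_dvd_mul_s7 {u v : G}
    (huv : ¬ IsOfFinOrder (QuotientGroup.mk' (Subgroup.zpowers u) v)) {f : MonoidAlgebra k G}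
    (h : of k G u - 1 ∣ (of k G v - 1) * f) : of k G u - 1 ∣ f := by
  set π := QuotientGroup.mk' (Subgroup.zpowers u)
  obtain ⟨b, hb⟩ := h
  apply of_sub_one_dvd_of_mapDomain_eq_zero_s7
  apply eq_zero_of_of_sub_one_mul_eq_zero huv
  have hof : ∀ g, mapDomainRingHom k π (of k G g) = of k _ (π g) := fun g ↦ by simp
  have hu : π u = 1 := (QuotientGroup.eq_one_iff u).2 (Subgroup.mem_zpowers u)
  have hπ := congrArg (mapDomainRingHom k π) hb
  rw [map_mul, map_mul, map_sub, map_sub, hof, hof, hu, map_one, map_one, sub_self,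
    zero_mul] at hπ
  exact hπ

/-- An ideal of finite index contains `x ^ n - 1` for all group elements `x`, for some `n > 0`. -/
theorem exists_of_pow_sub_one_mem (I : Ideal (MonoidAlgebra k G))
    [Finite (MonoidAlgebra k G ⧸ I)] :
    ∃ n : ℕ, 0 < n ∧ ∀ x : G, of k G (x ^ n) - 1 ∈ I := by
  let φ : G →* (MonoidAlgebra k G ⧸ I)ˣ :=
    ((Ideal.Quotient.mk I).toMonoidHom.comp (of k G)).toHomUnits
  refine ⟨Nat.card (MonoidAlgebra k G ⧸ I)ˣ, Nat.card_pos, fun x ↦ ?_⟩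
  rw [← Ideal.Quotient.mk_eq_mk_iff_sub_mem]
  have h : φ (x ^ Nat.card (MonoidAlgebra k G ⧸ I)ˣ) = 1 := by
    rw [map_pow, pow_card_eq_one']
  exact congrArg Units.val h

section Skew

variable {I : Ideal (MonoidAlgebra k G)} {α : G →* G} {μ : I →ₗ[k] MonoidAlgebra k G}

/-- Skewness for group elements extends to all of the group algebra. -/
theorem skew_of_skew_of
    (hμ : ∀ (x : G) (a : I), μ ⟨of k G x * a, I.mul_mem_left _ a.2⟩ = of k G (α x) * μ a)
    (r : MonoidAlgebra k G) (a : I) : μ (r • a) = mapDomainRingHom k α r * μ a := by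
  induction r using induction_on with
  | of x => simpa using! hμ x a
  | add x y hx hy => rw [add_smul, map_add, map_add, hx, hy, add_mul]
  | smul c x hx =>
    have hc : mapDomainRingHom k α (c • x) = c • mapDomainRingHom k α x :=
      map_smul (mapDomainAlgHom k k α) c x
    rw [smul_assoc, map_smul, hx, hc, smul_mul_assoc]

/-- A skew map on an ideal containing `u - 1` and `v - 1` is, up to applying `α`, multiplication
by an element of the group algebra, provided `α u` and `α v` are independent. -/
theorem exists_skew_eq_mul
    (hμ : ∀ (r : MonoidAlgebra k G) (a : I), μ (r • a) = mapDomainRingHom k α r * μ a)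
    {u v : G} (hu : of k G u - 1 ∈ I) (hv : of k G v - 1 ∈ I) (hαu : ¬ IsOfFinOrder (α u))
    (huv : ¬ IsOfFinOrder (QuotientGroup.mk' (Subgroup.zpowers (α u)) (α v))) :
    ∃ q, ∀ a : I, μ a = mapDomainRingHom k α a * q := by
  have hcomm : ∀ a b : I,
      mapDomainRingHom k α a * μ b = mapDomainRingHom k α b * μ a := fun a b ↦ by
    rw [← hμ, ← hμ]
    congr 1
    ext1
    exact mul_comm (a : MonoidAlgebra k G) b
  have hof : ∀ g, mapDomainRingHom k α (of k G g - 1) = of k G (α g) - 1 := fun g ↦ by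
    rw [map_sub, map_one]
    simp
  obtain ⟨q, hq⟩ : of k G (α u) - 1 ∣ μ ⟨_, hu⟩ := by
    apply of_sub_one_dvd_of_dvd_mul_s7 huv
    rw [← hof v, hcomm ⟨_, hv⟩ ⟨_, hu⟩, hof u]
    exact dvd_mul_right _ _
  refine ⟨q, fun a ↦ sub_eq_zero.1 (eq_zero_of_of_sub_one_mul_eq_zero hαu ?_)⟩
  have h := hcomm ⟨_, hu⟩ a
  rw [hq, hof u] at h
  rw [mul_sub, h]
  ring

/-- The ideal generated by all `x ^ n - 1` is stable under group endomorphisms. -/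
theorem mapDomainRingHom_mem_span_pow_sub_one (α : G →* G) (n : ℕ) {a : MonoidAlgebra k G}
    (ha : a ∈ Ideal.span (Set.range fun x : G ↦ of k G (x ^ n) - 1)) :
    mapDomainRingHom k α a ∈ Ideal.span (Set.range fun x : G ↦ of k G (x ^ n) - 1) := by
  rw [← Ideal.mem_comap]
  refine Ideal.span_le.2 ?_ ha
  rintro _ ⟨x, rfl⟩
  refine Ideal.subset_span ⟨α x, ?_⟩
  rw [map_sub, map_one]
  simp

end Skew

end MonoidAlgebra

open MonoidAlgebra in
/-- Let `p` be a prime, `k = GF(p)`, `d ≥ 2`, `X` a free abelian group of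
rank `d` (realized as `Multiplicative (Fin d →₀ ℤ)`), and `A = k[X]` its group algebra.
Let `I ≠ A` be an ideal with `A/I` finite, `α : X → X` a group endomorphism (whose `k`-algebra
extension `A → A` is determined by its values on group elements), and `μ : I → A` a `k`-linear
map with the skew condition `μ(r·ν) = α(r)·μ(ν)` for `r ∈ A`, `ν ∈ I` (by `k`-linearity this
is equivalent to the displayed condition for group elements).  Then `I` contains a nonzero
μ-invariant ideal of `A`. -/
theorem stmt7 (p : ℕ) (hp : p.Prime) (d : ℕ) (hd : 2 ≤ d)
    (I : Ideal (MonoidAlgebra (ZMod p) (Multiplicative (Fin d →₀ ℤ))))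
    (hItop : I ≠ ⊤)
    (hfin : Finite (MonoidAlgebra (ZMod p) (Multiplicative (Fin d →₀ ℤ)) ⧸ I))
    (α : Multiplicative (Fin d →₀ ℤ) →* Multiplicative (Fin d →₀ ℤ))
    (μ : ↥I →ₗ[ZMod p] MonoidAlgebra (ZMod p) (Multiplicative (Fin d →₀ ℤ)))
    (hskew : ∀ (x : Multiplicative (Fin d →₀ ℤ)) (ν : ↥I),
      μ ⟨MonoidAlgebra.of (ZMod p) (Multiplicative (Fin d →₀ ℤ)) x
            * (ν : MonoidAlgebra (ZMod p) (Multiplicative (Fin d →₀ ℤ))),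
          I.mul_mem_left _ ν.2⟩
        = MonoidAlgebra.of (ZMod p) (Multiplicative (Fin d →₀ ℤ)) (α x) * μ ν) :
    ∃ J : Ideal (MonoidAlgebra (ZMod p) (Multiplicative (Fin d →₀ ℤ))),
      J ≠ ⊥ ∧ ∃ hJ : J ≤ I, ∀ a (ha : a ∈ J), μ ⟨a, hJ ha⟩ ∈ J := by
  have : Fact p.Prime := ⟨hp⟩
  set X := Multiplicative (Fin d →₀ ℤ)
  have hμ := skew_of_skew_of hskew
  have htor : ∀ x : X, x ≠ 1 → ¬ IsOfFinOrder x := fun x hx h ↦ hx ((isOfFinOrder_iff_eq_one x).1 h)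
  obtain ⟨n, hn, hnI⟩ := exists_of_pow_sub_one_mem I
  let e (i : Fin d) : X := .ofAdd (Finsupp.single i 1)
  let i₀ : Fin d := ⟨0, by omega⟩
  let i₁ : Fin d := ⟨1, by omega⟩
  have hi : i₀ ≠ i₁ := by simp [i₀, i₁]
  have hindep : ∀ a b : ℤ, e i₀ ^ a = e i₁ ^ b → a = 0 ∧ b = 0 := by
    intro a b h
    have h' : a • Finsupp.single i₀ (1 : ℤ) = b • Finsupp.single i₁ (1 : ℤ) :=
      congrArg Multiplicative.toAdd h
    have h₀ := DFunLike.congr_fun h' i₀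
    have h₁ := DFunLike.congr_fun h' i₁
    simp [hi, hi.symm] at h₀ h₁
    exact ⟨h₀, h₁.symm⟩
  have he : e i₀ ^ n ≠ 1 := fun h ↦ by
    have := (hindep n 0 (by simpa using h)).1
    omega
  have hne : ∀ x : X, x ≠ 1 → of (ZMod p) X x - 1 ≠ 0 := fun x hx h ↦
    hx (of_injective (R := ZMod p) (by rwa [map_one, ← sub_eq_zero]))
  by_cases hα : Function.Injective α
  · have hαu : α (e i₀ ^ n) ≠ 1 := fun h ↦ he (hα (by rw [h, map_one]))
    have huv : ¬ IsOfFinOrder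
        (QuotientGroup.mk' (Subgroup.zpowers (α (e i₀ ^ n))) (α (e i₁ ^ n))) := by
      rw [isOfFinOrder_iff_pow_eq_one]
      rintro ⟨m, hm, h⟩
      rw [← map_pow (QuotientGroup.mk' _), QuotientGroup.mk'_apply, QuotientGroup.eq_one_iff,
        Subgroup.mem_zpowers_iff] at h
      obtain ⟨j, hj⟩ := h
      rw [← map_zpow α, ← map_pow α] at hj
      have hj' := hα hj
      have := (hindep (n * j) (n * m) (by
        rw [zpow_mul, zpow_mul]
        exact_mod_cast hj')).2
      have : (0 : ℤ) < n * m := by positivity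
      omega
    obtain ⟨q, hq⟩ := exists_skew_eq_mul hμ (hnI _) (hnI _) (htor _ hαu) huv
    have hJ : Ideal.span (Set.range fun x : X ↦ of (ZMod p) X (x ^ n) - 1) ≤ I :=
      Ideal.span_le.2 (by rintro _ ⟨x, rfl⟩; exact hnI x)
    refine ⟨_, fun h ↦ hne _ he ?_, hJ, fun a ha ↦ ?_⟩
    · rw [← Ideal.mem_bot, ← h]
      exact Ideal.subset_span ⟨_, rfl⟩
    · rw [hq]
      exact Ideal.mul_mem_right _ _ (mapDomainRingHom_mem_span_pow_sub_one α n ha)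
  · obtain ⟨x, hαx, hx⟩ : ∃ x, α x = 1 ∧ x ≠ 1 := by
      rw [injective_iff_map_eq_one] at hα
      push Not at hα
      exact hα
    refine ⟨Ideal.span {of (ZMod p) X x - 1} * I, fun h ↦ hne _ he ?_, Ideal.mul_le_right,
      fun a ha ↦ ?_⟩
    · apply eq_zero_of_of_sub_one_mul_eq_zero (htor x hx)
      rw [← Ideal.mem_bot, ← h]
      exact Ideal.mul_mem_mul (Ideal.mem_span_singleton_self _) (hnI _)
    · obtain ⟨b, hb, rfl⟩ := Ideal.mem_span_singleton_mul.1 ha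
      have h : μ ((of (ZMod p) X x - 1) • ⟨b, hb⟩) = 0 := by
        rw [hμ, map_sub, map_one]
        simp [hαx, MonoidAlgebra.one_def]
      have h' : μ ⟨(of (ZMod p) X x - 1) * b, Ideal.mul_le_right ha⟩ = 0 := h
      rw [h']
      exact Ideal.zero_mem _
end

section
/- Let p be a prime, k = ZMod p, A = k[x, x⁻¹] the Laurent polynomial ring over k (the group algebra of the infinite cyclic group ⟨x⟩), I the ideal of A generated by x − 1, n an integer, u ∈ A, and μ : I → A the (well-defined, since A is a domain) k-linear map determined by μ(r·(x−1)) = σₙ(r)·u for all r ∈ A, where σₙ : A → A is the k-algebra endomorphism with σₙ(x) = xⁿ. If p divides n, then the nonzero ideal J of A generated by (x−1)² satisfies J ⊆ I and μ(J) ⊆ J; in particular there is a nonzero μ-invariant ideal of A contained in I. -/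
open LaurentPolynomial

/-- The `k`-algebra endomorphism of the Laurent polynomial ring `k[x,x⁻¹]` sending `x` to `xⁿ`. -/
noncomputable def sigma (k : Type*) [CommSemiring k] (n : ℤ) :
    LaurentPolynomial k →ₐ[k] LaurentPolynomial k :=
  AddMonoidAlgebra.mapDomainAlgHom k k (zmultiplesHom ℤ n)

/-- `σₙ` sends `x` to `xⁿ`. -/
lemma sigma_T_one (k : Type*) [CommSemiring k] (n : ℤ) : sigma k n (T 1) = T n := by
  exact AddMonoidAlgebra.mapDomain_single.trans (by simp)

lemma T_one_sub_one_dvd_T_sub_one {k : Type*} [CommRing k] (m : ℤ) :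
    (T 1 - 1 : LaurentPolynomial k) ∣ T m - 1 := by
  have hnat (j : ℕ) : (T 1 - 1 : LaurentPolynomial k) ∣ T (j : ℤ) - 1 := by
    simpa [T_pow] using sub_dvd_pow_sub_pow (T 1 : LaurentPolynomial k) 1 j
  obtain ⟨j, rfl | rfl⟩ := m.eq_nat_or_neg
  · exact hnat j
  · have h : (T (-(j : ℤ)) - 1 : LaurentPolynomial k) = -T (-(j : ℤ)) * (T (j : ℤ) - 1) := by
      rw [mul_sub, neg_mul, ← T_add, neg_add_cancel, T_zero]
      ring
    exact h ▸ (hnat j).mul_left _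

/-- In characteristic `p`, if `p ∣ n` then `(x - 1) ^ p` divides `xⁿ - 1`. -/
lemma T_one_sub_one_pow_char_dvd {k : Type*} [CommRing k] (p : ℕ) [Fact p.Prime] [CharP k p]
    {n : ℤ} (hpn : (p : ℤ) ∣ n) :
    (T 1 - 1 : LaurentPolynomial k) ^ p ∣ T n - 1 := by
  obtain ⟨m, rfl⟩ := hpn
  have : CharP (LaurentPolynomial k) p :=
    charP_of_injective_algebraMap' k p
  have h : (T (p * m) - 1 : LaurentPolynomial k) = (T m - 1) ^ p := by
    rw [sub_pow_char, T_pow, one_pow]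
  exact h ▸ pow_dvd_pow_of_dvd (T_one_sub_one_dvd_T_sub_one m) p

lemma T_one_sub_one_ne_zero (k : Type*) [CommRing k] [Nontrivial k] :
    (T 1 - 1 : LaurentPolynomial k) ≠ 0 := by
  rw [sub_ne_zero, ← T_zero]
  exact fun h => one_ne_zero ((AddMonoidAlgebra.single_left_inj one_ne_zero).1 h)

/-- Let `p` be a prime, `k = ZMod p`, `A = k[x,x⁻¹]`, `I = (x − 1)`, `n` an
integer, `u ∈ A`, and `μ : I → A` the `k`-linear map with `μ(r(x−1)) = σₙ(r)·u`.  If `p ∣ n`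
then the nonzero ideal `J = ((x−1)²)` satisfies `J ⊆ I` and `μ(J) ⊆ J`; in particular there
is a nonzero μ-invariant ideal of `A` contained in `I`. -/
theorem stmt10 (p : ℕ) (hp : p.Prime) (n : ℤ) (u : LaurentPolynomial (ZMod p))
    (μ : ↥(Ideal.span {T 1 - 1} : Ideal (LaurentPolynomial (ZMod p))) →ₗ[ZMod p]
      LaurentPolynomial (ZMod p))
    (hμ : ∀ r : LaurentPolynomial (ZMod p),
      μ ⟨r * (T 1 - 1),
          Ideal.mul_mem_left _ r (Ideal.subset_span (Set.mem_singleton _))⟩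
        = sigma (ZMod p) n r * u)
    (hpn : (p : ℤ) ∣ n) :
    (Ideal.span {(T 1 - 1) ^ 2} : Ideal (LaurentPolynomial (ZMod p))) ≠ ⊥ ∧
    ∃ hJ : (Ideal.span {(T 1 - 1) ^ 2} : Ideal (LaurentPolynomial (ZMod p)))
        ≤ Ideal.span {T 1 - 1},
      (∀ a (ha : a ∈ (Ideal.span {(T 1 - 1) ^ 2} : Ideal (LaurentPolynomial (ZMod p)))),
        μ ⟨a, hJ ha⟩ ∈ (Ideal.span {(T 1 - 1) ^ 2} : Ideal (LaurentPolynomial (ZMod p)))) := by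
  have : Fact p.Prime := ⟨hp⟩
  refine ⟨?_, ?_⟩
  · rw [Ne, Ideal.span_singleton_eq_bot]
    exact pow_ne_zero 2 (T_one_sub_one_ne_zero _)
  · refine ⟨Ideal.span_singleton_le_span_singleton.2 (dvd_pow_self _ two_ne_zero), fun a ha => ?_⟩
    obtain ⟨s, rfl⟩ := Ideal.mem_span_singleton'.1 ha
    have h := hμ (s * (T 1 - 1))
    simp only [show s * (T 1 - 1) * (T 1 - 1) = s * (T 1 - 1) ^ 2 by ring] at h
    rw [h, map_mul, map_sub, map_one, sigma_T_one, Ideal.mem_span_singleton]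
    exact (((pow_dvd_pow _ hp.two_le).trans
      (T_one_sub_one_pow_char_dvd p hpn)).mul_left _).mul_right _
end

section
/- Let p be a prime, k = ZMod p, A = k[x, x⁻¹] the Laurent polynomial ring over k, c a nonzero element of k, M the ideal of A generated by x − c, and μ : M → A the (well-defined, since A is a domain) k-linear map determined by μ(r·(x−c)) = r for all r ∈ A. Then the only ideal J of A with J ⊆ M and μ(J) ⊆ J is the zero ideal. -/
open LaurentPolynomial

/-- Evaluation of Laurent polynomials at a unit `c` kills `T 1 - C c`, so this element generates
a proper ideal. -/
theorem LaurentPolynomial.span_T_sub_C_ne_top {k : Type*} [Field k] {c : k} (hc : c ≠ 0) :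
    (Ideal.span {T 1 - C c} : Ideal k[T;T⁻¹]) ≠ ⊤ := by
  intro h
  rw [Ideal.span_singleton_eq_top] at h
  have := h.map (eval₂ (RingHom.id k) (Units.mk0 c hc))
  simp at this

theorem LaurentPolynomial.isNoetherianRing_of_isNoetherianRing (k : Type*) [CommRing k]
    [IsNoetherianRing k] : IsNoetherianRing k[T;T⁻¹] :=
  IsLocalization.isNoetherianRing (Submonoid.powers (Polynomial.X : Polynomial k)) _ inferInstance

/-- Let `p` be a prime, `k = ZMod p`, `A = k[x,x⁻¹]`, `c ≠ 0` in `k`,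
`M = (x − c)`, and `μ : M → A` the `k`-linear map with `μ(r(x−c)) = r` for all `r ∈ A`.
Then the only μ-invariant ideal of `A` contained in `M` is zero. -/
theorem stmt12 (p : ℕ) (hp : p.Prime) (c : ZMod p) (hc : c ≠ 0)
    (μ : ↥(Ideal.span {T 1 - C c} : Ideal (LaurentPolynomial (ZMod p))) →ₗ[ZMod p]
      LaurentPolynomial (ZMod p))
    (hμ : ∀ r : LaurentPolynomial (ZMod p),
      μ ⟨r * (T 1 - C c),
          Ideal.mul_mem_left _ r (Ideal.subset_span (Set.mem_singleton _))⟩ = r) :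
    ∀ (J : Ideal (LaurentPolynomial (ZMod p)))
      (hJ : J ≤ Ideal.span {T 1 - C c}),
      (∀ a (ha : a ∈ J), μ ⟨a, hJ ha⟩ ∈ J) → J = ⊥ := by
  intro J hJ hinv
  have : Fact p.Prime := ⟨hp⟩
  have : IsNoetherianRing (LaurentPolynomial (ZMod p)) :=
    isNoetherianRing_of_isNoetherianRing _
  have hpow : ∀ n, J ≤ Ideal.span {T 1 - C c} ^ n := by
    intro n
    induction n with
    | zero => simp
    | succ n ih =>
      intro a ha
      obtain ⟨r, rfl⟩ := Ideal.mem_span_singleton'.1 (hJ ha)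
      have hr : r ∈ J := by simpa only [hμ] using hinv _ ha
      rw [pow_succ]
      exact Ideal.mul_mem_mul (ih hr) (Ideal.mem_span_singleton_self _)
  rw [eq_bot_iff, ← Ideal.iInf_pow_eq_bot_of_isDomain _ (span_T_sub_C_ne_top hc)]
  exact le_iInf hpow
end

section
/- Let p be a prime, k = ZMod p, A = k[x, x⁻¹] the Laurent polynomial ring over k, c a nonzero element of k, M the ideal of A generated by x − c, u ∈ A, and let n = p^s·n′ be an integer with s ≥ 1 and n′ coprime to p. Let μ : M → A be the k-linear map determined by μ(r·(x−c)) = σₙ(r)·u for all r ∈ A, where σₙ is the k-algebra endomorphism with σₙ(x) = xⁿ. If c^{n′−1} = 1 in k, then the nonzero ideal J of A generated by (x−c)² satisfies J ⊆ M and μ(J) ⊆ J; in particular there is a nonzero μ-invariant ideal of A contained in M. -/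
open LaurentPolynomial

theorem sigma_T (k : Type*) [CommSemiring k] (n m : ℤ) :
    sigma k n (T m) = T (m * n) := by
  simp only [sigma, T, AddMonoidAlgebra.mapDomainAlgHom_apply, AddMonoidAlgebra.mapDomain_single]
  simp only [zmultiplesHom_apply, smul_eq_mul]

theorem T_one_sub_C_dvd_T_sub_C_zpow {k : Type*} [Field k] {c : k} (hc : c ≠ 0) (m : ℤ) :
    (T 1 - C c : LaurentPolynomial k) ∣ T m - C (c ^ m) := by
  induction m using Int.induction_on with
  | zero => simp
  | succ i ih =>
    have h : (T (i + 1) - C (c ^ ((i : ℤ) + 1)) : LaurentPolynomial k)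
        = T i * (T 1 - C c) + (T i - C (c ^ (i : ℤ))) * C c := by
      rw [zpow_add_one₀ hc, map_mul, T_add]
      ring
    rw [h]
    exact dvd_add (dvd_mul_left _ _) (ih.mul_right _)
  | pred i ih =>
    have hcc : (C c * C c⁻¹ : LaurentPolynomial k) = 1 := by
      rw [← map_mul, mul_inv_cancel₀ hc, map_one]
    have hT : (T (-(i : ℤ)) : LaurentPolynomial k) = T (-(i : ℤ) - 1) * T 1 := by
      rw [← T_add, sub_add_cancel]
    have h : (T (-(i : ℤ) - 1) - C (c ^ (-(i : ℤ) - 1)) : LaurentPolynomial k)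
        = (T (-(i : ℤ)) - C (c ^ (-(i : ℤ)))) * C c⁻¹
          - T (-(i : ℤ) - 1) * C c⁻¹ * (T 1 - C c) := by
      rw [zpow_sub_one₀ hc, map_mul, hT]
      linear_combination (-T (-(i : ℤ) - 1)) * hcc
    rw [h]
    exact dvd_sub (ih.mul_right _) (dvd_mul_left _ _)

theorem T_one_sub_C_ne_zero {k : Type*} [Field k] (c : k) :
    (T 1 - C c : LaurentPolynomial k) ≠ 0 := by
  intro h
  have := congrArg (fun f : LaurentPolynomial k => f.coeff 1) h
  simp at this

/-- Over `ZMod p`, if `c ^ m = c` then `x - c` divides `x ^ m - c`, hence its `p ^ s`-th power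
divides `x ^ (p ^ s * m) - c`. -/
theorem T_one_sub_C_pow_dvd_T_sub_C (p : ℕ) [Fact p.Prime] {c : ZMod p} (hc : c ≠ 0)
    (s : ℕ) {m : ℤ} (hm : c ^ m = c) :
    (T 1 - C c : LaurentPolynomial (ZMod p)) ^ p ^ s ∣ T ((p : ℤ) ^ s * m) - C c := by
  have : CharP (LaurentPolynomial (ZMod p)) p :=
    charP_of_injective_algebraMap (algebraMap (ZMod p) (LaurentPolynomial (ZMod p))).injective p
  have h := pow_dvd_pow_of_dvd (T_one_sub_C_dvd_T_sub_C_zpow hc m) (p ^ s)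
  rw [hm, sub_pow_char_pow (p := p) (T m) (C c), T_pow, ← map_pow, ZMod.pow_card_pow] at h
  exact_mod_cast h

/-- Let `p` be a prime, `k = ZMod p`, `A = k[x,x⁻¹]`, `c ≠ 0` in `k`,
`M = (x − c)`, `u ∈ A`, and `n = p^s·n′` with `s ≥ 1` and `n′` coprime to `p`.  Let
`μ : M → A` be the `k`-linear map with `μ(r(x−c)) = σₙ(r)·u`.  If `c^{n′−1} = 1` then the
nonzero ideal `J = ((x−c)²)` satisfies `J ⊆ M` and `μ(J) ⊆ J`; in particular there is a
nonzero μ-invariant ideal of `A` contained in `M`. -/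
theorem stmt14 (p : ℕ) [Fact p.Prime] (c : ZMod p) (hc : c ≠ 0)
    (s : ℕ) (hs : 1 ≤ s) (n' : ℤ) (hn' : IsCoprime n' (p : ℤ)) (n : ℤ)
    (hn : n = (p : ℤ) ^ s * n')
    (u : LaurentPolynomial (ZMod p))
    (μ : ↥(Ideal.span {T 1 - C c} : Ideal (LaurentPolynomial (ZMod p))) →ₗ[ZMod p]
      LaurentPolynomial (ZMod p))
    (hμ : ∀ r : LaurentPolynomial (ZMod p),
      μ ⟨r * (T 1 - C c),
          Ideal.mul_mem_left _ r (Ideal.subset_span (Set.mem_singleton _))⟩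
        = sigma (ZMod p) n r * u)
    (hcn : c ^ (n' - 1) = 1) :
    (Ideal.span {(T 1 - C c) ^ 2} : Ideal (LaurentPolynomial (ZMod p))) ≠ ⊥ ∧
    ∃ hJ : (Ideal.span {(T 1 - C c) ^ 2} : Ideal (LaurentPolynomial (ZMod p)))
        ≤ Ideal.span {T 1 - C c},
      (∀ a (ha : a ∈ (Ideal.span {(T 1 - C c) ^ 2} : Ideal (LaurentPolynomial (ZMod p)))),
        μ ⟨a, hJ ha⟩ ∈ (Ideal.span {(T 1 - C c) ^ 2} : Ideal (LaurentPolynomial (ZMod p)))) := by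
  refine ⟨?_, ?_, ?_⟩
  · rw [Ne, Ideal.span_singleton_eq_bot]
    exact pow_ne_zero 2 (T_one_sub_C_ne_zero c)
  · exact Ideal.span_singleton_le_span_singleton.2 (dvd_pow_self _ two_ne_zero)
  · intro a ha
    obtain ⟨b, rfl⟩ := Ideal.mem_span_singleton'.1 ha
    have hcn' : c ^ n' = c := by
      rw [zpow_sub_one₀ hc] at hcn
      exact (mul_inv_eq_one₀ hc).1 hcn
    have hp : 2 ≤ p ^ s :=
      (Fact.out : p.Prime).two_le.trans (Nat.le_self_pow (by lia) p)
    have hσ : sigma (ZMod p) n (T 1 - C c) = T n - C c := by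
      rw [map_sub, sigma_T, one_mul, C_eq_algebraMap, AlgHom.commutes]
    have hd : (T 1 - C c) ^ 2 ∣ sigma (ZMod p) n (T 1 - C c) := by
      rw [hσ, hn]
      exact (pow_dvd_pow _ hp).trans (T_one_sub_C_pow_dvd_T_sub_C p hc s hcn')
    have h := hμ (b * (T 1 - C c))
    simp only [mul_assoc b, ← sq] at h
    rw [h, Ideal.mem_span_singleton, map_mul]
    exact (hd.mul_left _).mul_right _
end
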